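/- arXiv:math-ph/0701076 — 2 statements merged into one kernel-verified Lean document; each statement's English description precedes it below -/
import Mathlib

section
/- Let A be a unital associative algebra over ℂ, let a, x ∈ A and λ ∈ ℂ be such that λ•1 − a is invertible, and set r := (λ•1 − a)⁻¹. Then for every integer K ≥ 1, r*x − x*r = Σ_{k=1}^{K} (ad_a^k x) * r^{k+1} + (r * (ad_a^K x) − (ad_a^K x) * r) * r^{K}. -/
/-- The commutator with a resolvent `r` of `a` is the bracket with `a` sandwiched between two
copies of `r`. -/
theorem resolvent_commutator_eq_mul_bracket_mul {R A : Type*} [CommRing R] [Ring A] [Algebra R A]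
    {a r : A} {l : R} (hr₁ : (l • (1 : A) - a) * r = 1) (hr₂ : r * (l • (1 : A) - a) = 1) (y : A) :
    r * y - y * r = r * (a * y - y * a) * r := by
  have h : a * y - y * a = y * (l • (1 : A) - a) - (l • (1 : A) - a) * y := by
    simp only [mul_sub, sub_mul, mul_smul_comm, smul_mul_assoc, mul_one, one_mul]
    abel
  rw [h, mul_sub, sub_mul, ← mul_assoc r _ y, hr₂, one_mul, mul_assoc r, mul_assoc y, hr₁, mul_one]

/-- Expansion of the commutator of a resolvent `r = (λ•1 - a)⁻¹` with `x` into
iterated brackets `ad_a^k x` with an explicit remainder term. -/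
theorem resolvent_commutator_expansion
    {A : Type*} [Ring A] [Algebra ℂ A]
    (a x r : A) (l : ℂ)
    (hr₁ : (l • (1 : A) - a) * r = 1) (hr₂ : r * (l • (1 : A) - a) = 1)
    (K : ℕ) (hK : 1 ≤ K) :
    r * x - x * r =
      (∑ k ∈ Finset.Icc 1 K, ((fun y => a * y - y * a)^[k] x) * r ^ (k + 1)) +
        (r * ((fun y => a * y - y * a)^[K] x)
          - ((fun y => a * y - y * a)^[K] x) * r) * r ^ K := by
  clear hK
  induction K with
  | zero => simp
  | succ n ih =>
    rw [ih, Finset.sum_Icc_succ_top (by lia), Function.iterate_succ_apply',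
      resolvent_commutator_eq_mul_bracket_mul hr₁ hr₂, add_assoc]
    congr 1
    simp only [sub_mul, mul_sub, pow_succ' r, mul_assoc]
    abel
end

section
/- Let n ≥ 1, m ≥ 1, α ∈ ℂ and j ∈ ℕ, and let b : ℝ → ((EuclideanSpace ℝ (Fin n)) ∖ {0}) → Matrix (Fin m) (Fin m) ℂ be such that: (i) for every z ∈ ℝ, every t > 0 and every ξ ≠ 0, b z (t•ξ) = exp((α·z − j)·log t) • (b z ξ); (ii) for every ξ ≠ 0 the map z ↦ b z ξ is differentiable at 0. Then for every ξ ≠ 0, the derivative at z = 0 of z ↦ b z ξ equals α·(log ‖ξ‖) • (b 0 ξ) + ‖ξ‖^{−j} • (derivative at z = 0 of z ↦ b z (ξ/‖ξ‖)). In particular, if j = 0 and b 0 ξ = 1 (the identity matrix) for all ξ ≠ 0, then (d/dz)|₀ b z ξ = α·(log ‖ξ‖) • 1 + (d/dz)|₀ b z (ξ/‖ξ‖), the second summand being positively homogeneous of degree 0. -/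
attribute [local instance] Matrix.normedAddCommGroup Matrix.normedSpace

/-- The `z`-derivative at `0` of the homogeneity factor `t ^ (α z - j)`. -/
theorem hasDerivAt_exp_mul_sub_mul_log (α : ℂ) (j : ℕ) (t : ℝ) :
    HasDerivAt (fun z : ℝ => Complex.exp ((α * z - j) * Real.log t))
      (Complex.exp (-j * Real.log t) * (α * Real.log t)) 0 := by
  have h : HasDerivAt (fun z : ℝ => (α * (z : ℂ) - j) * Real.log t) (α * Real.log t) 0 := by
    simpa using (((Complex.ofRealCLM.hasDerivAt (x := (0 : ℝ))).const_mul α).sub_const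
      (j : ℂ)).mul_const (Real.log t : ℂ)
  simpa using h.cexp

theorem Complex.exp_neg_natCast_mul_log (j : ℕ) {t : ℝ} (ht : 0 < t) :
    Complex.exp (-j * Real.log t) = (((t ^ j)⁻¹ : ℝ) : ℂ) := by
  rw [neg_mul, Complex.exp_neg, Complex.exp_nat_mul, ← Complex.ofReal_exp, Real.exp_log ht]
  push_cast
  rfl

/-- For a family `b z` of matrix-valued functions on `ℝⁿ ∖ {0}`, positively homogeneous
of complex degree `α·z - j` and differentiable in `z` at `0`, the `z`-derivative at `0`
satisfies `(d/dz)|₀ b z ξ = α log‖ξ‖ • b 0 ξ + ‖ξ‖^{-j} • (d/dz)|₀ b z (ξ/‖ξ‖)`.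
In particular, if `j = 0` and `b 0 ξ = 1` for all `ξ ≠ 0`, then
`(d/dz)|₀ b z ξ = α log‖ξ‖ • 1 + (d/dz)|₀ b z (ξ/‖ξ‖)`. -/
theorem deriv_homogeneous_family_log_decomposition
    (n m : ℕ) (hn : 1 ≤ n) (hm : 1 ≤ m) (α : ℂ) (j : ℕ)
    (b : ℝ → EuclideanSpace ℝ (Fin n) → Matrix (Fin m) (Fin m) ℂ)
    (hb_hom : ∀ z : ℝ, ∀ t : ℝ, 0 < t → ∀ ξ : EuclideanSpace ℝ (Fin n), ξ ≠ 0 →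
      b z (t • ξ) = Complex.exp ((α * z - j) * Real.log t) • b z ξ)
    (hb_diff : ∀ ξ : EuclideanSpace ℝ (Fin n), ξ ≠ 0 →
      DifferentiableAt ℝ (fun z => b z ξ) 0) :
    (∀ ξ : EuclideanSpace ℝ (Fin n), ξ ≠ 0 →
        deriv (fun z => b z ξ) 0 =
          (α * Real.log ‖ξ‖) • b 0 ξ +
            ((‖ξ‖ ^ j : ℝ)⁻¹ : ℝ) • deriv (fun z => b z (‖ξ‖⁻¹ • ξ)) 0) ∧
      (j = 0 → (∀ ξ : EuclideanSpace ℝ (Fin n), ξ ≠ 0 → b 0 ξ = 1) →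
        ∀ ξ : EuclideanSpace ℝ (Fin n), ξ ≠ 0 →
          deriv (fun z => b z ξ) 0 =
            (α * Real.log ‖ξ‖) • (1 : Matrix (Fin m) (Fin m) ℂ) +
              deriv (fun z => b z (‖ξ‖⁻¹ • ξ)) 0) := by
  have key : ∀ ξ : EuclideanSpace ℝ (Fin n), ξ ≠ 0 →
      deriv (fun z => b z ξ) 0 =
        (α * Real.log ‖ξ‖) • b 0 ξ +
          ((‖ξ‖ ^ j : ℝ)⁻¹ : ℝ) • deriv (fun z => b z (‖ξ‖⁻¹ • ξ)) 0 := by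
    intro ξ hξ
    have hpos : 0 < ‖ξ‖ := norm_pos_iff.mpr hξ
    have hη : ‖ξ‖⁻¹ • ξ ≠ 0 := smul_ne_zero (inv_ne_zero hpos.ne') hξ
    have hfac : ∀ z : ℝ, b z ξ =
        Complex.exp ((α * z - j) * Real.log ‖ξ‖) • b z (‖ξ‖⁻¹ • ξ) := fun z => by
      rw [← hb_hom z ‖ξ‖ hpos _ hη, smul_inv_smul₀ hpos.ne']
    have hd := (hasDerivAt_exp_mul_sub_mul_log α j ‖ξ‖).smul (hb_diff _ hη).hasDerivAt
    have h0 := hfac 0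
    simp only [Complex.ofReal_zero, mul_zero, zero_sub] at h0
    rw [funext hfac]
    refine hd.deriv.trans ?_
    simp only [Complex.ofReal_zero, mul_zero, zero_sub]
    rw [h0, smul_smul, add_comm, mul_comm (α * _),
      ← Complex.coe_smul (‖ξ‖ ^ j)⁻¹, Complex.exp_neg_natCast_mul_log j hpos]
    rfl
  refine ⟨key, fun hj h1 ξ hξ => ?_⟩
  subst hj
  simpa [h1 ξ hξ] using key ξ hξ
end
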